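/- Let k ≥ 2 be an integer. If G is a finite simple graph of order n with minimum degree δ(G) ≥ √((193/30)(k−1)n), then G has a k-proper partition 𝒫 with |𝒫| ≤ (1/(k−1))·√((193/30)(k−1)n) = √(193n/(30(k−1))). -/

import Mathlib

open SimpleGraph

/-- A graph is `k`-connected if the removal of any set of fewer than `k` vertices
results in a connected graph with at least two vertices. -/
def KConnected {V : Type*} (k : ℕ) (G : SimpleGraph V) : Prop :=
  ∀ S : Set V, S.ncard < k → (G.induce Sᶜ).Connected ∧ 2 ≤ Sᶜ.ncard

/-- A partition of the vertex set of `G` is `k`-proper if every part induces a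
`k`-connected subgraph. -/
def KProperPartition {V : Type*} [Fintype V] [DecidableEq V] (k : ℕ) (G : SimpleGraph V)
    (P : Finpartition (Finset.univ : Finset V)) : Prop :=
  ∀ p ∈ P.parts, KConnected k (G.induce (p : Set V))

section Separations

variable {V : Type*} [DecidableEq V] (G : SimpleGraph V)

/-- `A` has no proper separation `(B, C)` of order less than `k` in `G[A]`. -/
def NoSmallSeparation (k : ℕ) (A : Finset V) : Prop :=
  ∀ B C : Finset V, B ∪ C = A → (B ∩ C).card < k →
    (∀ b ∈ B \ C, ∀ c ∈ C \ B, ¬ G.Adj b c) → B ⊆ C ∨ C ⊆ B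

variable {G}

theorem NoSmallSeparation.kConnected_induce {k : ℕ} {A : Finset V}
    (h : NoSmallSeparation G k A) (hk : k < A.card) :
    KConnected k (G.induce (A : Set V)) := by
  classical
  intro S hS
  have hcard : S.ncard + Sᶜ.ncard = A.card := by
    rw [Set.ncard_add_ncard_compl]
    simp
  have h2 : 2 ≤ Sᶜ.ncard := by omega
  refine ⟨?_, h2⟩
  have hne : (Sᶜ).Nonempty := by
    rw [← Set.ncard_pos]; omega
  have : Nonempty (Sᶜ : Set _) := hne.to_subtype
  refine ⟨?_⟩
  intro u v
  by_contra hr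
  set H := (G.induce (A : Set V)).induce Sᶜ with hH
  let R : Set V := {x | ∃ (hx : x ∈ (A : Set V)) (hx' : (⟨x, hx⟩ : (A : Set V)) ∈ Sᶜ),
    H.Reachable u ⟨⟨x, hx⟩, hx'⟩}
  let X : Set V := Subtype.val '' S
  have hXA : ∀ x ∈ X, x ∈ A := by
    rintro _ ⟨y, -, rfl⟩
    exact y.2
  have hRX : ∀ x ∈ R, x ∉ X := by
    rintro x ⟨hx, hx', -⟩ ⟨y, hy, hyx⟩
    subst hyx
    exact hx' hy
  have hRA : ∀ x ∈ R, x ∈ A := fun x hx => hx.1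
  have hX : (A.filter (· ∈ X)).card < k := by
    have : ((A.filter (· ∈ X) : Finset V) : Set V) = X := by
      ext x
      simpa using hXA x
    rw [← Set.ncard_coe_finset, this, Set.ncard_image_of_injective _ Subtype.val_injective]
    exact hS
  have key := h (A.filter (fun x => x ∈ X ∨ x ∈ R)) (A.filter (fun x => x ∉ R)) ?_ ?_ ?_
  · have hu : (u.1.1 : V) ∈ R := ⟨u.1.2, u.2, Reachable.refl _⟩
    have hv : (v.1.1 : V) ∉ R := fun ⟨_, _, hv⟩ => hr hv
    have hvX : (v.1.1 : V) ∉ X := by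
      rintro ⟨y, hy, hyv⟩
      exact v.2 (Subtype.ext hyv ▸ hy)
    have huA : (u.1.1 : V) ∈ A := u.1.2
    have hvA : (v.1.1 : V) ∈ A := v.1.2
    rcases key with key | key
    · have := @key u.1.1 (by simp [huA, hu])
      simp [hu] at this
    · have := @key v.1.1 (by simp [hvA, hv])
      simp [hv, hvX] at this
  · ext x
    simp only [Finset.mem_union, Finset.mem_filter]
    tauto
  · refine lt_of_le_of_lt (Finset.card_le_card ?_) hX
    intro x
    simp only [Finset.mem_inter, Finset.mem_filter]
    tauto
  · intro b hb c hc hbc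
    simp only [Finset.mem_sdiff, Finset.mem_filter, not_and, not_or, not_not] at hb hc
    have hbR : b ∈ R := hb.2 hb.1.1
    have hcX : c ∉ X := fun hcX => (hc.2 hc.1.1).1 hcX
    obtain ⟨hbA, hbS, hreach⟩ := hbR
    have hcA : c ∈ (A : Set V) := hc.1.1
    have hcS : (⟨c, hcA⟩ : (A : Set V)) ∈ Sᶜ := fun hS' => hcX ⟨_, hS', rfl⟩
    refine hc.1.2 ⟨hcA, hcS, hreach.trans ?_⟩
    apply Adj.reachable
    simpa [hH] using hbc

theorem NoSmallSeparation.insert_vertex [DecidableRel G.Adj] {k : ℕ} {A : Finset V}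
    (h : NoSmallSeparation G k A) {v : V} (hvA : v ∉ A)
    (hv : k ≤ (A.filter (G.Adj v)).card) : NoSmallSeparation G k (insert v A) := by
  have single : ∀ B C : Finset V, B ∪ C = insert v A → (B ∩ C).card < k →
      (∀ b ∈ B \ C, ∀ c ∈ C \ B, ¬ G.Adj b c) → B.erase v ⊆ C.erase v → B ⊆ C := by
    intro B C hU hI hE hs x hx
    by_cases hxv : x = v
    · subst hxv
      by_contra hxC
      refine absurd (hv.trans (Finset.card_le_card ?_)) (not_le.mpr hI)
      intro w hw
      rw [Finset.mem_filter] at hw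
      have hwx : w ≠ x := fun e => hvA (e ▸ hw.1)
      have hwU : w ∈ B ∪ C := hU ▸ Finset.mem_insert_of_mem hw.1
      have hwC : w ∈ C := by
        rcases Finset.mem_union.mp hwU with hwB | hwC
        · exact Finset.mem_of_mem_erase (hs (Finset.mem_erase.mpr ⟨hwx, hwB⟩))
        · exact hwC
      by_contra hwI
      have hwB : w ∉ B := fun hwB => hwI (Finset.mem_inter.mpr ⟨hwB, hwC⟩)
      exact hE x (Finset.mem_sdiff.mpr ⟨hx, hxC⟩) w (Finset.mem_sdiff.mpr ⟨hwC, hwB⟩) hw.2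
    · exact Finset.mem_of_mem_erase (hs (Finset.mem_erase.mpr ⟨hxv, hx⟩))
  intro B C hU hI hE
  have := h (B.erase v) (C.erase v) ?_ ?_ ?_
  · refine this.imp (single B C hU hI hE) (single C B ?_ ?_ ?_)
    · rw [Finset.union_comm, hU]
    · rwa [Finset.inter_comm]
    · exact fun b hb c hc hbc => hE c hc b hb hbc.symm
  · rw [← Finset.erase_union_distrib, hU, Finset.erase_insert hvA]
  · refine lt_of_le_of_lt (Finset.card_le_card ?_) hI
    exact Finset.inter_subset_inter (Finset.erase_subset _ _) (Finset.erase_subset _ _)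
  · intro b hb c hc
    simp only [Finset.mem_sdiff, Finset.mem_erase, not_and] at hb hc
    exact hE b (by simp; tauto) c (by simp; tauto)

end Separations

section Mader

variable {V : Type*} (G : SimpleGraph V) [DecidableRel G.Adj]

/-- The darts of `G` with both ends in `S`. -/
def dartsIn (S : Finset V) : Finset (V × V) :=
  (S ×ˢ S).filter (fun e => G.Adj e.1 e.2)

theorem card_dartsIn_eq_sum (S : Finset V) :
    (dartsIn G S).card = ∑ v ∈ S, (S.filter (G.Adj v)).card := by
  simp only [dartsIn, Finset.card_filter, Finset.sum_product]

theorem card_dartsIn_le (S : Finset V) : (dartsIn G S).card + S.card ≤ S.card * S.card := by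
  classical
  have h : dartsIn G S ⊆ S.offDiag := by
    intro e he
    simp only [dartsIn, Finset.mem_filter, Finset.mem_product] at he
    exact Finset.mem_offDiag.mpr ⟨he.1.1, he.1.2, he.2.ne⟩
  have := Finset.card_le_card h
  rw [Finset.offDiag_card] at this
  have := Nat.le_mul_self S.card
  omega

variable [DecidableEq V]

theorem card_dartsIn_le_erase (S : Finset V) (v : V) :
    (dartsIn G S).card ≤ (dartsIn G (S.erase v)).card + 2 * (S.filter (G.Adj v)).card := by
  have h : dartsIn G S ⊆ dartsIn G (S.erase v) ∪
      ((S.filter (G.Adj v)).image (fun w => (v, w)) ∪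
        (S.filter (G.Adj v)).image (fun w => (w, v))) := by
    rintro ⟨a, b⟩ he
    simp only [dartsIn, Finset.mem_filter, Finset.mem_product, Finset.mem_union,
      Finset.mem_image, Finset.mem_erase, Prod.mk.injEq] at he ⊢
    by_cases ha : a = v
    · subst ha
      exact Or.inr (Or.inl ⟨b, ⟨he.1.2, he.2⟩, rfl, rfl⟩)
    · by_cases hb : b = v
      · subst hb
        exact Or.inr (Or.inr ⟨a, ⟨he.1.1, he.2.symm⟩, rfl, rfl⟩)
      · exact Or.inl ⟨⟨⟨ha, he.1.1⟩, hb, he.1.2⟩, he.2⟩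
  have h1 := Finset.card_le_card h
  have h2 := Finset.card_union_le (dartsIn G (S.erase v))
    ((S.filter (G.Adj v)).image (fun w => (v, w)) ∪
        (S.filter (G.Adj v)).image (fun w => (w, v)))
  have h3 := Finset.card_union_le ((S.filter (G.Adj v)).image (fun w => (v, w)))
    ((S.filter (G.Adj v)).image (fun w => (w, v)))
  have h4 := Finset.card_image_le (s := S.filter (G.Adj v)) (f := fun w => (v, w))
  have h5 := Finset.card_image_le (s := S.filter (G.Adj v)) (f := fun w => (w, v))
  omega

theorem card_dartsIn_union_le {B C : Finset V}
    (h : ∀ b ∈ B \ C, ∀ c ∈ C \ B, ¬ G.Adj b c) :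
    (dartsIn G (B ∪ C)).card ≤ (dartsIn G B).card + (dartsIn G C).card := by
  refine (Finset.card_le_card ?_).trans (Finset.card_union_le _ _)
  rintro ⟨a, b⟩ he
  simp only [dartsIn, Finset.mem_filter, Finset.mem_product, Finset.mem_union] at he ⊢
  have h1 := h a
  have h2 := h b
  have h3 : G.Adj b a := he.2.symm
  simp only [Finset.mem_sdiff] at h1 h2
  by_contra hcon
  by_cases haB : a ∈ B <;> by_cases haC : a ∈ C <;> by_cases hbB : b ∈ B <;>
    by_cases hbC : b ∈ C <;> simp_all

/-- A form of Mader's theorem: a graph of minimum degree `d ≥ 4m` has an `(m+1)`-connected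
subgraph on more than `d / 2 + 1` vertices. -/
theorem exists_noSmallSeparation_of_le_degree {m d : ℕ} (hm : 1 ≤ m) (hd : 4 * m ≤ d)
    {H : Finset V} (hH : H.Nonempty) (hdeg : ∀ v ∈ H, d ≤ (H.filter (G.Adj v)).card) :
    ∃ S ⊆ H, NoSmallSeparation G (m + 1) S ∧ d + 3 ≤ 2 * S.card := by
  have hHgood : 2 * m ≤ H.card ∧ d * H.card < (dartsIn G H).card + d * m := by
    obtain ⟨v, hv⟩ := hH
    refine ⟨?_, ?_⟩
    · have := (hdeg v hv).trans (Finset.card_filter_le _ _)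
      omega
    · have h1 : H.card * d ≤ (dartsIn G H).card := by
        rw [card_dartsIn_eq_sum]
        simpa using Finset.card_nsmul_le_sum H _ d hdeg
      have : 0 < d * m := Nat.mul_pos (by omega) hm
      nlinarith
  let good : Finset V → Prop := fun S => S ⊆ H ∧ 2 * m ≤ S.card ∧
    d * S.card < (dartsIn G S).card + d * m
  have hex : ∃ S, good S := ⟨H, subset_rfl, hHgood⟩
  obtain ⟨S, ⟨hSH, hS2, hSe⟩, hmin⟩ := WellFounded.has_min
    (measure (Finset.card : Finset V → ℕ)).wf {S | good S} hex
  have hmin' : ∀ T ⊆ S, 2 * m ≤ T.card → T.card < S.card →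
      (dartsIn G T).card + d * m ≤ d * T.card := by
    intro T hTS hT hlt
    by_contra hcon
    exact hmin T ⟨hTS.trans hSH, hT, not_le.mp hcon⟩ hlt
  have hS3 : 2 * m < S.card := by
    refine lt_of_le_of_ne hS2 fun heq => ?_
    have := card_dartsIn_le G S
    rw [← heq] at this hSe
    nlinarith
  have hdegS : ∀ v ∈ S, d < 2 * (S.filter (G.Adj v)).card := by
    intro v hv
    have h1 := Finset.card_erase_add_one hv
    have h2 := hmin' (S.erase v) (Finset.erase_subset _ _) (by omega) (by omega)
    have h3 := card_dartsIn_le_erase G S v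
    rw [← h1] at hSe
    nlinarith
  have hfilter : ∀ v ∈ S, ∀ T : Finset V, v ∈ T → (∀ w ∈ S, G.Adj v w → w ∈ T) →
      d + 3 ≤ 2 * T.card := by
    intro v hv T hvT hT
    have hsub : S.filter (G.Adj v) ⊆ T.erase v := by
      intro w hw
      rw [Finset.mem_filter] at hw
      exact Finset.mem_erase.mpr ⟨hw.2.ne', hT w hw.1 hw.2⟩
    have h1 := Finset.card_le_card hsub
    have h2 := Finset.card_erase_add_one hvT
    have h3 := hdegS v hv
    omega
  refine ⟨S, hSH, ?_, ?_⟩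
  · intro B C hU hI hE
    by_contra hcon
    rw [not_or, Finset.not_subset, Finset.not_subset] at hcon
    obtain ⟨⟨b, hbB, hbC⟩, ⟨c, hcC, hcB⟩⟩ := hcon
    have hBS : B ⊆ S := hU ▸ Finset.subset_union_left
    have hCS : C ⊆ S := hU ▸ Finset.subset_union_right
    have hB := hfilter b (hBS hbB) B hbB (by
      intro w hw hbw
      by_contra hwB
      have hwC : w ∈ C := (Finset.mem_union.mp (hU ▸ hw)).resolve_left hwB
      exact hE b (by simp [hbB, hbC]) w (by simp [hwC, hwB]) hbw)
    have hC := hfilter c (hCS hcC) C hcC (by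
      intro w hw hcw
      by_contra hwC
      have hwB : w ∈ B := (Finset.mem_union.mp (hU ▸ hw)).resolve_right hwC
      exact hE w (by simp [hwB, hwC]) c (by simp [hcC, hcB]) hcw.symm)
    have hBlt : B.card < S.card :=
      Finset.card_lt_card ⟨hBS, fun h => hcB (h (hCS hcC))⟩
    have hClt : C.card < S.card :=
      Finset.card_lt_card ⟨hCS, fun h => hbC (h (hBS hbB))⟩
    have h1 := hmin' B hBS (by omega) hBlt
    have h2 := hmin' C hCS (by omega) hClt
    have h3 := card_dartsIn_union_le G hE
    have h4 := Finset.card_union_add_card_inter B C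
    rw [hU] at h3 h4
    have h5 : d * (B ∩ C).card ≤ d * m := Nat.mul_le_mul_left _ (by omega)
    have h6 : d * S.card + d * (B ∩ C).card = d * B.card + d * C.card := by
      rw [← Nat.mul_add, h4, Nat.mul_add]
    omega
  · obtain ⟨v, hv⟩ : S.Nonempty := Finset.card_pos.mp (by omega)
    exact hfilter v hv S hv fun w hw _ => hw

end Mader

section Partition

variable {V : Type*} [Fintype V] [DecidableEq V] (G : SimpleGraph V)

/-- A partial colouring of the vertices with `p` colours all of whose colour classes are
`(m+1)`-connected and which leaves few vertices uncoloured. -/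
structure IsPartialPartition (m D p : ℕ) (f : V → Option ℕ) : Prop where
  lt_of_eq_some : ∀ v i, f v = some i → i < p
  lt_card : ∀ i < p, m + 1 < (Finset.univ.filter (f · = some i)).card
  noSmallSeparation : ∀ i < p,
    NoSmallSeparation G (m + 1) (Finset.univ.filter (f · = some i))
  card_uncoloured : 2 * p * D + p * m + 4 * (Finset.univ.filter (f · = none)).card ≤
    4 * Fintype.card V + p * p * m
  le_or : p = 0 ∨ (p + 3) * m ≤ D

variable {G}

theorem IsPartialPartition.absorb [DecidableRel G.Adj] {m D p : ℕ} {f : V → Option ℕ}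
    (h : IsPartialPartition G m D p f) {v : V} (hv : f v = none) {i : ℕ} (hi : i < p)
    (hvi : m + 1 ≤ ((Finset.univ.filter (f · = some i)).filter (G.Adj v)).card) :
    IsPartialPartition G m D p (Function.update f v (some i)) := by
  have hself : Finset.univ.filter (Function.update f v (some i) · = some i) =
      insert v (Finset.univ.filter (f · = some i)) := by
    ext w
    by_cases hw : w = v <;> simp [Function.update_apply, hw]
  have hother : ∀ j ≠ i, Finset.univ.filter (Function.update f v (some i) · = some j) =
      Finset.univ.filter (f · = some j) := by
    intro j hj
    ext w
    by_cases hw : w = v <;> simp [Function.update_apply, hw, hv, hj.symm]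
  refine ⟨?_, ?_, ?_, ?_, h.le_or⟩
  · intro w j
    by_cases hw : w = v
    · subst hw
      simp only [Function.update_self, Option.some.injEq]
      rintro rfl
      exact hi
    · rw [Function.update_of_ne hw]
      exact h.lt_of_eq_some w j
  · intro j hj
    by_cases hji : j = i
    · subst hji
      rw [hself]
      exact (h.lt_card j hj).trans_le (Finset.card_le_card (Finset.subset_insert _ _))
    · rw [hother j hji]
      exact h.lt_card j hj
  · intro j hj
    by_cases hji : j = i
    · subst hji
      rw [hself]
      exact (h.noSmallSeparation j hj).insert_vertex (by simp [hv]) hvi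
    · rw [hother j hji]
      exact h.noSmallSeparation j hj
  · refine le_trans ?_ h.card_uncoloured
    refine Nat.add_le_add_left (Nat.mul_le_mul_left 4 (Finset.card_le_card ?_)) _
    refine Finset.monotone_filter_right _ fun w _ hw => ?_
    by_cases hwv : w = v
    · rw [hwv, hv]
    · rwa [Function.update_of_ne hwv] at hw

theorem IsPartialPartition.addPart {m D p : ℕ} {f : V → Option ℕ}
    (h : IsPartialPartition G m D p f) (hD : (p + 4) * m ≤ D) {S : Finset V}
    (hSf : S ⊆ Finset.univ.filter (f · = none)) (hm : 1 ≤ m)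
    (hS : NoSmallSeparation G (m + 1) S) (hcard : D + 3 ≤ 2 * S.card + p * m) :
    IsPartialPartition G m D (p + 1) (fun v => if v ∈ S then some p else f v) := by
  have hSn : ∀ v ∈ S, f v = none := fun v hv => (Finset.mem_filter.mp (hSf hv)).2
  have hself : Finset.univ.filter
      ((fun v => if v ∈ S then some p else f v) · = some p) = S := by
    ext w
    by_cases hw : w ∈ S
    · simp [hw]
    · simp only [Finset.mem_filter, Finset.mem_univ, true_and, hw, if_false, iff_false]
      exact fun he => (h.lt_of_eq_some w p he).false
  have hother : ∀ j < p, Finset.univ.filter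
      ((fun v => if v ∈ S then some p else f v) · = some j) =
      Finset.univ.filter (f · = some j) := by
    intro j hj
    ext w
    by_cases hw : w ∈ S
    · simp [hw, hSn w hw, hj.ne']
    · simp [hw]
  have hnone : Finset.univ.filter
      ((fun v => if v ∈ S then some p else f v) · = none) =
      Finset.univ.filter (f · = none) \ S := by
    ext w
    by_cases hw : w ∈ S <;> simp [hw]
  refine ⟨?_, ?_, ?_, ?_, Or.inr (by linarith)⟩
  · intro w j
    by_cases hw : w ∈ S
    · simp only [hw, if_true, Option.some.injEq]
      omega
    · simp only [hw, if_false]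
      exact fun he => (h.lt_of_eq_some w j he).trans (Nat.lt_succ_self p)
  · intro j hj
    rcases Nat.lt_succ_iff_lt_or_eq.mp hj with hj | rfl
    · rw [hother j hj]
      exact h.lt_card j hj
    · rw [hself]
      nlinarith
  · intro j hj
    rcases Nat.lt_succ_iff_lt_or_eq.mp hj with hj | rfl
    · rw [hother j hj]
      exact h.noSmallSeparation j hj
    · rwa [hself]
  · have h1 := h.card_uncoloured
    rw [hnone]
    have h2 := Finset.card_sdiff_add_card_eq_card hSf
    nlinarith

theorem IsPartialPartition.exists_forall_ne_none [DecidableRel G.Adj] {m D : ℕ} (hm : 1 ≤ m)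
    (hD : D ≤ G.minDegree) (hn : 4 * m * Fintype.card V ≤ D * D) {p : ℕ} {f : V → Option ℕ}
    (h : IsPartialPartition G m D p f) :
    ∃ q g, IsPartialPartition G m D q g ∧ ∀ v, g v ≠ none := by
  induction hc : (Finset.univ.filter (f · = none)).card using Nat.strong_induction_on
    generalizing p f with
  | _ c ih =>
  subst hc
  by_cases hall : ∀ v, f v ≠ none
  · exact ⟨p, f, h, hall⟩
  push Not at hall
  obtain ⟨v, hv⟩ := hall
  by_cases habs : ∃ v i, f v = none ∧ i < p ∧
      m + 1 ≤ ((Finset.univ.filter (f · = some i)).filter (G.Adj v)).card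
  · obtain ⟨v, i, hv, hi, hvi⟩ := habs
    refine ih _ ?_ (h.absorb hv hi hvi) rfl
    refine Finset.card_lt_card ((Finset.ssubset_iff_of_subset ?_).mpr ⟨v, ?_, ?_⟩)
    · intro w
      by_cases hwv : w = v <;> simp [Function.update_apply, hwv]
    · simp [hv]
    · simp
  push Not at habs
  set L := Finset.univ.filter (f · = none) with hL
  have hdeg : ∀ w ∈ L, D ≤ (L.filter (G.Adj w)).card + p * m := by
    intro w hw
    have hwn : f w = none := (Finset.mem_filter.mp hw).2
    have hsub : G.neighborFinset w ⊆ L.filter (G.Adj w) ∪ (Finset.range p).biUnion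
        (fun i => (Finset.univ.filter (f · = some i)).filter (G.Adj w)) := by
      intro x hx
      rw [mem_neighborFinset] at hx
      rcases hfx : f x with _ | i
      · simp [hL, hfx, hx]
      · have := h.lt_of_eq_some x i hfx
        simp [hfx, hx, this]
    have h1 := (Finset.card_le_card hsub).trans (Finset.card_union_le _ _)
    have h2 := Finset.card_biUnion_le_card_mul (Finset.range p)
      (fun i => (Finset.univ.filter (f · = some i)).filter (G.Adj w)) m
      (fun i hi => Nat.lt_succ_iff.mp (habs w i hwn (Finset.mem_range.mp hi)))
    rw [Finset.card_range] at h2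
    have h3 := G.minDegree_le_degree w
    rw [card_neighborFinset_eq_degree] at h1
    omega
  have hvL : v ∈ L := by simp [hL, hv]
  by_cases hbig : (p + 4) * m ≤ D
  · obtain ⟨S, hSL, hS, hScard⟩ := exists_noSmallSeparation_of_le_degree G (d := D - p * m) hm
      (by rw [add_mul] at hbig; omega) ⟨v, hvL⟩ (fun w hw => by have := hdeg w hw; omega)
    have hpm : p * m ≤ D := by nlinarith
    refine ih _ ?_ (h.addPart hbig hSL hm hS (by omega)) rfl
    have hpos : S.Nonempty := Finset.card_pos.mp (by omega)
    obtain ⟨s, hs⟩ := hpos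
    refine Finset.card_lt_card ((Finset.ssubset_iff_of_subset ?_).mpr ⟨s, hSL hs, ?_⟩)
    · intro w
      by_cases hwS : w ∈ S <;> simp [hwS, hL]
    · simp [hs]
  · exfalso
    have hLcard : D + 1 ≤ L.card + p * m := by
      have h1 : L.filter (G.Adj v) ⊆ L.erase v := fun w hw => by
        rw [Finset.mem_filter] at hw
        exact Finset.mem_erase.mpr ⟨hw.2.ne', hw.1⟩
      have h2 := Finset.card_le_card h1
      have h3 := Finset.card_erase_add_one hvL
      have h4 := hdeg v hvL
      omega
    have hpm : p * m ≤ D := by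
      rcases h.le_or with h0 | h0
      · simp [h0]
      · nlinarith
    obtain ⟨y, rfl⟩ := Nat.exists_eq_add_of_le hpm
    have hy : y ≤ 4 * m := by nlinarith
    have hc := Nat.mul_le_mul_left m h.card_uncoloured
    have hyL : y + 1 ≤ L.card := by omega
    have h5 : m * (y + 1) ≤ m * L.card := Nat.mul_le_mul_left m hyL
    have h6 : y * y ≤ 4 * m * y := Nat.mul_le_mul_right y hy
    nlinarith [Nat.zero_le (p * m * m)]

theorem IsPartialPartition.exists_kProperPartition {m D p : ℕ} {f : V → Option ℕ}
    (h : IsPartialPartition G m D p f) (hf : ∀ v, f v ≠ none) :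
    ∃ P : Finpartition (Finset.univ : Finset V), KProperPartition (m + 1) G P ∧
      P.parts.card ≤ p := by
  let P : Finpartition (Finset.univ : Finset V) :=
    { parts := (Finset.range p).image (fun i => Finset.univ.filter (f · = some i))
      supIndep := by
        rw [Finset.supIndep_iff_pairwiseDisjoint]
        intro A hA B hB hAB
        simp only [Finset.coe_image, Set.mem_image] at hA hB
        obtain ⟨i, -, rfl⟩ := hA
        obtain ⟨j, -, rfl⟩ := hB
        refine Finset.disjoint_left.mpr fun x hx hx' => hAB ?_
        simp only [id, Finset.mem_filter] at hx hx'
        have hij : i = j := Option.some.inj (hx.2.symm.trans hx'.2)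
        rw [hij]
      sup_parts := by
        ext v
        obtain ⟨i, hi⟩ := Option.ne_none_iff_exists'.mp (hf v)
        have := h.lt_of_eq_some v i hi
        simp only [Finset.mem_sup, Finset.mem_image, Finset.mem_univ, iff_true]
        exact ⟨_, ⟨i, Finset.mem_range.mpr this, rfl⟩, by simp [hi]⟩
      bot_notMem := by
        intro hbot
        obtain ⟨i, hi, he⟩ := Finset.mem_image.mp hbot
        have := h.lt_card i (Finset.mem_range.mp hi)
        rw [he] at this
        simp at this }
  refine ⟨P, ?_, ?_⟩
  · intro A hA
    obtain ⟨i, hi, rfl⟩ := Finset.mem_image.mp hA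
    have hi := Finset.mem_range.mp hi
    exact (h.noSmallSeparation i hi).kConnected_induce (h.lt_card i hi)
  · simpa using Finset.card_image_le (s := Finset.range p)
      (f := fun i => Finset.univ.filter (f · = some i))

/-- A graph of order `n` and minimum degree at least `D ≥ 2√(mn)` has an `(m+1)`-proper
partition with at most `D / m - 3` parts (or none, if `n = 0`). -/
theorem exists_kProperPartition_of_le_minDegree [DecidableRel G.Adj] {m D : ℕ} (hm : 1 ≤ m)
    (hD : D ≤ G.minDegree) (hn : 4 * m * Fintype.card V ≤ D * D) :
    ∃ P : Finpartition (Finset.univ : Finset V), KProperPartition (m + 1) G P ∧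
      (P.parts.card = 0 ∨ (P.parts.card + 3) * m ≤ D) := by
  have h0 : IsPartialPartition G m D 0 (fun _ : V => none) :=
    ⟨by simp, by simp, by simp, by simp, Or.inl rfl⟩
  obtain ⟨q, g, hq, hg⟩ := h0.exists_forall_ne_none hm hD hn
  obtain ⟨P, hP, hcard⟩ := hq.exists_kProperPartition hg
  refine ⟨P, hP, ?_⟩
  rcases hq.le_or with h | h
  · left
    omega
  · right
    exact (Nat.mul_le_mul_right m (by omega)).trans h

end Partition

/-- **Theorem 12.** If `k ≥ 2` and `δ(G) ≥ √((193/30)(k-1)n)`, then `G` has a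
`k`-proper partition into at most `(1/(k-1))·√((193/30)(k-1)n)` parts. -/
theorem k_proper_partition_improved {V : Type*} [Fintype V] [DecidableEq V]
    (k : ℕ) (hk : 2 ≤ k) (G : SimpleGraph V) [DecidableRel G.Adj]
    (hδ : (G.minDegree : ℝ) ≥
      Real.sqrt ((193 / 30) * ((k : ℝ) - 1) * (Fintype.card V : ℝ))) :
    ∃ P : Finpartition (Finset.univ : Finset V), KProperPartition k G P ∧
      (P.parts.card : ℝ) ≤ (1 / ((k : ℝ) - 1)) *
        Real.sqrt ((193 / 30) * ((k : ℝ) - 1) * (Fintype.card V : ℝ)) := by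
  obtain ⟨m, rfl⟩ : ∃ m, k = m + 1 := ⟨k - 1, by omega⟩
  have hm : 1 ≤ m := by omega
  have hm' : (1 : ℝ) ≤ m := by exact_mod_cast hm
  have hk' : ((m + 1 : ℕ) : ℝ) - 1 = m := by push_cast; ring
  rw [hk'] at hδ ⊢
  set s := Real.sqrt ((193 / 30) * (m : ℝ) * (Fintype.card V : ℝ)) with hs
  have hs0 : 0 ≤ s := Real.sqrt_nonneg _
  have hsq : s * s = (193 / 30) * (m : ℝ) * (Fintype.card V : ℝ) :=
    Real.mul_self_sqrt (by positivity)
  have hceil : s ≤ (⌈s⌉₊ : ℝ) := Nat.le_ceil s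
  obtain ⟨P, hP, hcard⟩ := exists_kProperPartition_of_le_minDegree (G := G) (D := ⌈s⌉₊) hm
    (Nat.ceil_le.mpr hδ) (by
      have h1 : (0 : ℝ) ≤ m * (Fintype.card V : ℝ) := by positivity
      have : (4 * m * Fintype.card V : ℝ) ≤ ⌈s⌉₊ * ⌈s⌉₊ := by
        nlinarith [mul_self_le_mul_self hs0 hceil]
      exact_mod_cast this)
  refine ⟨P, hP, ?_⟩
  rw [one_div, ← div_eq_inv_mul, le_div_iff₀ (by linarith)]
  rcases hcard with h0 | h0
  · simpa [h0] using hs0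
  · have h1 : ((P.parts.card : ℝ) + 3) * m ≤ (⌈s⌉₊ : ℝ) := by exact_mod_cast h0
    have h2 := Nat.ceil_lt_add_one hs0
    linarith
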